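/- Let H be a nonzero m×n real matrix with full column rank. Then the minimum of |support(H·c)| over all c ∈ ℝⁿ with H·c ≠ 0 is equal to the minimum cardinality of an (algebraic) observability set of H; in particular both minima are attained over nonempty families. (Algebraic form of Proposition 1 / Problem 2: the stealthy attack of lowest cardinality corresponds to attacking the smallest critical/observability set) -/

import Mathlib

/-- The submatrix of `H` obtained by deleting the rows indexed by `S`. -/
def delRows {m n : ℕ} (H : Matrix (Fin m) (Fin n) ℝ) (S : Set (Fin m)) :
    Matrix {i : Fin m // i ∉ S} (Fin n) ℝ :=
  Matrix.of fun i j => H i.1 j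

/-- `S` is an (algebraic) observability set: `H^(−S)` has nontrivial kernel, while adding
back any single row `k ∈ S` yields a matrix with trivial kernel. -/
def IsObsSet {m n : ℕ} (H : Matrix (Fin m) (Fin n) ℝ) (S : Set (Fin m)) : Prop :=
  (∃ c : Fin n → ℝ, c ≠ 0 ∧ (delRows H S).mulVec c = 0) ∧
  (∀ k ∈ S, ∀ c : Fin n → ℝ, (delRows H (S \ {k})).mulVec c = 0 → c = 0)

theorem delRows_mulVec_eq_zero_iff {m n : ℕ} (H : Matrix (Fin m) (Fin n) ℝ) (S : Set (Fin m))
    (c : Fin n → ℝ) :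
    (delRows H S).mulVec c = 0 ↔ Function.support (H.mulVec c) ⊆ S := by
  constructor
  · intro h i hi
    by_contra hiS
    exact hi (congrFun h ⟨i, hiS⟩)
  · intro h
    funext i
    by_contra hi
    exact i.2 (h hi)

theorem Matrix.mulVec_injective_of_rank_eq {m n : ℕ} (H : Matrix (Fin m) (Fin n) ℝ)
    (hH : H.rank = n) : Function.Injective H.mulVec := by
  rw [Matrix.mulVec_injective_iff, linearIndependent_iff_card_eq_finrank_span,
    Set.finrank, ← Matrix.rank_eq_finrank_span_cols, hH, Fintype.card_fin]

theorem IsObsSet.exists_support_eq {m n : ℕ} {H : Matrix (Fin m) (Fin n) ℝ} {S : Set (Fin m)}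
    (hS : IsObsSet H S) : ∃ c : Fin n → ℝ, c ≠ 0 ∧ Function.support (H.mulVec c) = S := by
  obtain ⟨⟨c, hc, hcS⟩, hmin⟩ := hS
  rw [delRows_mulVec_eq_zero_iff] at hcS
  refine ⟨c, hc, hcS.antisymm fun k hk => ?_⟩
  by_contra hkc
  refine hc (hmin k hk c ?_)
  rw [delRows_mulVec_eq_zero_iff]
  exact Set.subset_sdiff_singleton hcS hkc

theorem isObsSet_support_of_minimal {m n : ℕ} {H : Matrix (Fin m) (Fin n) ℝ}
    (hinj : Function.Injective H.mulVec) {c : Fin n → ℝ} (hc : H.mulVec c ≠ 0)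
    (hmin : ∀ d : Fin n → ℝ, H.mulVec d ≠ 0 →
      (Function.support (H.mulVec c)).ncard ≤ (Function.support (H.mulVec d)).ncard) :
    IsObsSet H (Function.support (H.mulVec c)) := by
  refine ⟨⟨c, ?_, (delRows_mulVec_eq_zero_iff H _ c).2 subset_rfl⟩, fun k hk d hd => ?_⟩
  · rintro rfl
    exact hc (Matrix.mulVec_zero H)
  · rw [delRows_mulVec_eq_zero_iff] at hd
    by_contra hd0
    have hHd : H.mulVec d ≠ 0 := fun h => hd0 (hinj (h.trans (Matrix.mulVec_zero H).symm))
    have hle := Set.ncard_le_ncard hd (Set.toFinite _)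
    have hlt := Set.ncard_sdiff_singleton_lt_of_mem hk (Set.toFinite _)
    exact absurd (hmin d hHd) (by omega)

/-- Algebraic form of Proposition 1 / Problem 2: for a nonzero `H` of full column rank,
the minimum cardinality of the support of a nonzero stealthy attack `H·c` equals the
minimum cardinality of an (algebraic) observability set of `H`; both minima are attained
over nonempty families. -/
theorem sparsest_stealthy_attack
    {m n : ℕ} (H : Matrix (Fin m) (Fin n) ℝ) (hH0 : H ≠ 0) (hH : H.rank = n) :
    {s : ℕ | ∃ c : Fin n → ℝ, H.mulVec c ≠ 0 ∧
        s = (Function.support (H.mulVec c)).ncard}.Nonempty ∧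
    {s : ℕ | ∃ S : Set (Fin m), IsObsSet H S ∧ s = S.ncard}.Nonempty ∧
    sInf {s : ℕ | ∃ c : Fin n → ℝ, H.mulVec c ≠ 0 ∧
        s = (Function.support (H.mulVec c)).ncard} =
      sInf {s : ℕ | ∃ S : Set (Fin m), IsObsSet H S ∧ s = S.ncard} := by
  have hinj := Matrix.mulVec_injective_of_rank_eq H hH
  set A := {s : ℕ | ∃ c : Fin n → ℝ, H.mulVec c ≠ 0 ∧
    s = (Function.support (H.mulVec c)).ncard}
  set B := {s : ℕ | ∃ S : Set (Fin m), IsObsSet H S ∧ s = S.ncard}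
  have hne : A.Nonempty := by
    by_contra hempty
    refine hH0 (Matrix.ext_of_mulVec_single fun j => ?_)
    rw [Matrix.zero_mulVec]
    by_contra hj
    exact hempty ⟨_, _, hj, rfl⟩
  have hBA : B ⊆ A := by
    rintro s ⟨S, hS, rfl⟩
    obtain ⟨c, hc, hcS⟩ := hS.exists_support_eq
    exact ⟨c, fun h => hc (hinj (h.trans (Matrix.mulVec_zero H).symm)), by rw [hcS]⟩
  have hmem : sInf A ∈ B := by
    obtain ⟨c, hc, hcs⟩ := Nat.sInf_mem hne
    exact ⟨_, isObsSet_support_of_minimal hinj hc fun d hd => hcs ▸ Nat.sInf_le ⟨d, hd, rfl⟩, hcs⟩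
  have hBne : B.Nonempty := ⟨_, hmem⟩
  exact ⟨hne, hBne, le_antisymm (Nat.sInf_le (hBA (Nat.sInf_mem hBne))) (Nat.sInf_le hmem)⟩
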